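/- Let G be a connected finite simple non-bipartite graph with diameter d, and let g0 ∈ G be an initial node with eccentricity e. Then synchronous flooding from g0 terminates after j rounds for some j with e < j ≤ e + d + 1; that is, there exists j with e < j ≤ e + d + 1 such that R_j ≠ ∅ and R_i = ∅ for all i > j. -/

import Mathlib

namespace SimpleGraph

variable {V : Type*} (G : SimpleGraph V)

/-- `i` is the least length of a walk from `g0` to `v` among the walks whose length has the
parity of `i`. -/
def IsParityDist (g0 : V) (i : ℕ) (v : V) : Prop :=
  (∃ w : G.Walk g0 v, w.length = i) ∧ ∀ w : G.Walk g0 v, w.length % 2 = i % 2 → i ≤ w.length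

variable {G} {g0 : V}

lemma Walk.exists_isParityDist {v : V} (w : G.Walk g0 v) :
    ∃ i ≤ w.length, i % 2 = w.length % 2 ∧ G.IsParityDist g0 i v := by
  classical
  have hex : ∃ i, i % 2 = w.length % 2 ∧ ∃ w' : G.Walk g0 v, w'.length = i := ⟨_, rfl, w, rfl⟩
  refine ⟨Nat.find hex, Nat.find_min' hex ⟨rfl, w, rfl⟩, (Nat.find_spec hex).1,
    (Nat.find_spec hex).2, fun w' hw' => Nat.find_min' hex ⟨?_, w', rfl⟩⟩
  rw [hw', (Nat.find_spec hex).1]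

lemma IsParityDist.eq_of_mod_eq {i j : ℕ} {v : V} (hi : G.IsParityDist g0 i v)
    (hj : G.IsParityDist g0 j v) (h : i % 2 = j % 2) : i = j := by
  obtain ⟨⟨w, hw⟩, hi⟩ := hi
  obtain ⟨⟨w', hw'⟩, hj⟩ := hj
  have := hi w' (by omega)
  have := hj w (by omega)
  omega

lemma isParityDist_zero {v : V} : G.IsParityDist g0 0 v ↔ v = g0 := by
  constructor
  · rintro ⟨⟨w, hw⟩, -⟩
    exact (Walk.eq_of_length_eq_zero hw).symm
  · rintro rfl
    exact ⟨⟨.nil, rfl⟩, by simp⟩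

lemma Adj.isParityDist_one {v : V} (h : G.Adj g0 v) : G.IsParityDist g0 1 v :=
  ⟨⟨h.toWalk, by simp⟩, fun w hw => by omega⟩

lemma IsParityDist.of_adj {i : ℕ} {g h : V} (hg : G.IsParityDist g0 (i + 1) g) (hgh : G.Adj g h) :
    G.IsParityDist g0 (i + 2) h ∨ G.IsParityDist g0 i h := by
  obtain ⟨⟨w, hw⟩, hmin⟩ := hg
  obtain ⟨m, hm, hpar, hmh⟩ := (w.concat hgh).exists_isParityDist
  obtain ⟨w', hw'⟩ := hmh.1
  rw [Walk.length_concat] at hm hpar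
  have := hmin (w'.concat hgh.symm) (by rw [Walk.length_concat]; omega)
  rw [Walk.length_concat] at this
  obtain rfl | rfl : m = i + 2 ∨ m = i := by omega
  · exact .inl hmh
  · exact .inr hmh

lemma IsParityDist.exists_adj {i : ℕ} {h : V} (hh : G.IsParityDist g0 (i + 1) h) :
    ∃ g, G.Adj g h ∧ G.IsParityDist g0 i g := by
  obtain ⟨⟨w, hw⟩, hmin⟩ := hh
  have hnil : ¬ w.Nil := by
    rw [← Walk.length_eq_zero_iff]
    omega
  have hadj := w.adj_penultimate hnil
  have hlen : w.dropLast.length = i := by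
    have := congrArg Walk.length (w.concat_dropLast hadj)
    rw [Walk.length_concat] at this
    omega
  refine ⟨_, hadj, ⟨_, hlen⟩, fun w' hw' => ?_⟩
  have := hmin (w'.concat hadj) (by rw [Walk.length_concat]; omega)
  rw [Walk.length_concat] at this
  omega

lemma Connected.exists_adj_dist_eq (hconn : G.Connected) (hnb : ¬ G.Colorable 2) (g0 : V) :
    ∃ a b, G.Adj a b ∧ G.dist g0 a = G.dist g0 b := by
  by_contra! hne
  refine hnb ?_
  let c : G.Coloring Bool := Coloring.mk (fun v => decide (G.dist g0 v % 2 = 0)) <| by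
    intro a b hab h
    have h1 := hne a b hab
    have h2 := hconn.dist_triangle (u := g0) (v := a) (w := b)
    have h3 := hconn.dist_triangle (u := g0) (v := b) (w := a)
    rw [dist_eq_one_iff_adj.mpr hab] at h2
    rw [dist_eq_one_iff_adj.mpr hab.symm] at h3
    rw [decide_eq_decide] at h
    omega
  simpa using c.colorable

lemma Connected.exists_walk_mod_two (hconn : G.Connected) (hnb : ¬ G.Colorable 2) {e d : ℕ}
    (he : ∀ v, G.dist g0 v ≤ e) (hd : ∀ u v, G.dist u v ≤ d) (v : V) (p : ℕ) :
    ∃ w : G.Walk g0 v, w.length % 2 = p % 2 ∧ w.length ≤ e + d + 1 := by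
  obtain ⟨a, b, hab, hdist⟩ := hconn.exists_adj_dist_eq hnb g0
  obtain ⟨wa, hwa⟩ := hconn.exists_walk_length_eq_dist g0 a
  obtain ⟨wb, hwb⟩ := hconn.exists_walk_length_eq_dist g0 b
  obtain ⟨w, hw⟩ := hconn.exists_walk_length_eq_dist a v
  have := he a
  have := hd a v
  have h1 : (wa.append w).length = G.dist g0 a + G.dist a v := by
    rw [Walk.length_append, hwa, hw]
  have h2 : ((wb.concat hab.symm).append w).length = G.dist g0 a + G.dist a v + 1 := by
    rw [Walk.length_append, Walk.length_concat, hwb, hw, hdist]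
    omega
  by_cases hp : (G.dist g0 a + G.dist a v) % 2 = p % 2
  · exact ⟨_, by rw [h1, hp], by omega⟩
  · exact ⟨_, by rw [h2]; omega, by omega⟩

lemma mem_flooding_iff {M : ℕ → Set (V × V)}
    (hM1 : M 1 = {p : V × V | p.1 = g0 ∧ G.Adj g0 p.2})
    (hMsucc : ∀ i ≥ 1, M (i + 1) =
      {p : V × V | G.Adj p.1 p.2 ∧ (∃ f, (f, p.1) ∈ M i) ∧ (p.2, p.1) ∉ M i})
    (i : ℕ) (g h : V) : (g, h) ∈ M (i + 1) ↔
      G.Adj g h ∧ G.IsParityDist g0 i g ∧ G.IsParityDist g0 (i + 1) h := by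
  induction i generalizing g h with
  | zero =>
    simp only [zero_add, hM1, Set.mem_ofPred_eq, isParityDist_zero]
    constructor
    · rintro ⟨rfl, hadj⟩
      exact ⟨hadj, rfl, hadj.isParityDist_one⟩
    · rintro ⟨hadj, rfl, -⟩
      exact ⟨rfl, hadj⟩
  | succ i ih =>
    simp only [hMsucc (i + 1) (by omega), Set.mem_ofPred_eq, ih]
    constructor
    · rintro ⟨hadj, ⟨f, -, -, hg⟩, hnot⟩
      exact ⟨hadj, hg, (hg.of_adj hadj).resolve_right fun hh => hnot ⟨hadj.symm, hh, hg⟩⟩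
    · rintro ⟨hadj, hg, hh⟩
      obtain ⟨f, hf, hfi⟩ := hg.exists_adj
      refine ⟨hadj, ⟨f, hf, hfi, hg⟩, fun ⟨_, hh', _⟩ => ?_⟩
      have := hh.eq_of_mod_eq hh' (by omega)
      omega

end SimpleGraph

theorem stmt12 {V : Type*} [Fintype V] (G : SimpleGraph V)
    (hconn : G.Connected) (g0 : V)
    (M : ℕ → Set (V × V)) (R : ℕ → Set V)
    (hM1 : M 1 = {p : V × V | p.1 = g0 ∧ G.Adj g0 p.2})
    (hMsucc : ∀ i ≥ 1, M (i + 1) =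
      {p : V × V | G.Adj p.1 p.2 ∧ (∃ f, (f, p.1) ∈ M i) ∧ (p.2, p.1) ∉ M i})
    (hR0 : R 0 = {g0})
    (hRi : ∀ i ≥ 1, R i = {h : V | ∃ g, (g, h) ∈ M i})
    (hnb : ¬ G.Colorable 2)
    (e : ℕ) (he : IsGreatest {k : ℕ | ∃ g : V, G.dist g0 g = k} e)
    (d : ℕ) (hd : IsGreatest {k : ℕ | ∃ u v : V, G.dist u v = k} d) :
    ∃ j : ℕ, e < j ∧ j ≤ e + d + 1 ∧ R j ≠ ∅ ∧ ∀ i > j, R i = ∅ := by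
  have hR : ∀ i ≥ 1, ∀ h, h ∈ R i ↔ G.IsParityDist g0 i h := by
    intro i hi h
    obtain ⟨i, rfl⟩ := Nat.exists_eq_add_of_le' hi
    simp only [hRi _ hi, Set.mem_ofPred_eq, SimpleGraph.mem_flooding_iff hM1 hMsucc]
    constructor
    · rintro ⟨g, -, -, hh⟩
      exact hh
    · intro hh
      obtain ⟨g, hadj, hg⟩ := hh.exists_adj
      exact ⟨g, hadj, hg, hh⟩
  have hwalk := hconn.exists_walk_mod_two hnb (g0 := g0) (fun v => he.2 ⟨v, rfl⟩)
    (fun u v => hd.2 ⟨u, v, rfl⟩)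
  have hbound : ∀ i v, G.IsParityDist g0 i v → i ≤ e + d + 1 := by
    intro i v hv
    obtain ⟨w, hpar, hle⟩ := hwalk v i
    exact (hv.2 w hpar).trans hle
  obtain ⟨⟨v, hv⟩, -⟩ := he
  obtain ⟨w, hpar, -⟩ := hwalk v (e + 1)
  obtain ⟨k, -, hk, hkv⟩ := w.exists_isParityDist
  have hek : e < k := by
    obtain ⟨w', hw'⟩ := hkv.1
    have := SimpleGraph.dist_le w'
    omega
  classical
  let j := Nat.findGreatest (fun i => ∃ v, G.IsParityDist g0 i v) (e + d + 1)
  have hkj : k ≤ j := Nat.le_findGreatest (hbound k v hkv) ⟨v, hkv⟩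
  have hj : ∃ v, G.IsParityDist g0 j v :=
    Nat.findGreatest_spec (P := fun i => ∃ v, G.IsParityDist g0 i v) (hbound k v hkv) ⟨v, hkv⟩
  refine ⟨j, by omega, Nat.findGreatest_le _, ?_, fun i hi => ?_⟩
  · obtain ⟨u, hu⟩ := hj
    exact Set.nonempty_iff_ne_empty.mp ⟨u, (hR j (by omega) u).mpr hu⟩
  · refine Set.eq_empty_of_forall_notMem fun u hu => ?_
    have hu := (hR i (by omega) u).mp hu
    exact absurd (Nat.le_findGreatest (hbound i u hu) ⟨u, hu⟩) (not_le.mpr hi)
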